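/- Let Q = (J,σ,ξ) be a Q-datum and 𝐢 a reduced word of w₀ adapted to Q. Suppose (ι,p) ∈ J × ℤ satisfies (ι, p−𝗌_{\barι}) ∈ Im Ω̃_Q and (ι, p+𝗌_{\barι}) ∈ Im Ω̃_Q, and let 𝐦 ∈ ℤ^{R⁺} be the unique element with Ω_Q(𝐦) = α_{\barι,p}. Then there is exactly one index 1 ≤ k₀ ≤ L with Ω̃_Q(β_{k₀}) = (ι, p+𝗌_{\barι}), and for every 1 ≤ k ≤ L one has Σ_{t=1}^{k} 𝐦(β_t)·(ν_k, β_t) = δ_{k,k₀}. -/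

import Mathlib

open scoped BigOperators Classical

namespace QDatumPaper

structure CartanADE (J : Type) [Fintype J] [DecidableEq J] where
  a : J → J → ℤ
  symm : ∀ ι j : J, a ι j = a j ι
  diag : ∀ ι : J, a ι ι = 2
  offDiag : ∀ ι j : J, ι ≠ j → a ι j = 0 ∨ a ι j = -1
  posDef : ∀ v : J → ℚ, v ≠ 0 → 0 < ∑ ι : J, ∑ j : J, v ι * (a ι j : ℚ) * v j
  indec : ∀ s : Set J, s.Nonempty →
    (∀ ι ∈ s, ∀ j : J, a ι j = -1 → j ∈ s) → s = Set.univ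

variable {J : Type} [Fintype J] [DecidableEq J]

/-- `j` lies in the `σ`-orbit of `ι`. -/
def SameOrbit (σ : Equiv.Perm J) (ι j : J) : Prop := ∃ k : ℕ, (σ ^ k) ι = j

/-- The size `𝗌_{\barι}` of the `σ`-orbit of `ι`. -/
noncomputable def orbitSize (σ : Equiv.Perm J) (ι : J) : ℕ :=
  ((Finset.range (orderOf σ)).image fun k => (σ ^ k) ι).card

/-- A diagram automorphism of the Cartan matrix `C`: no two distinct vertices in a common
orbit are adjacent. -/
structure DiagAut (C : CartanADE J) where
  σ : Equiv.Perm J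
  compat : ∀ ι j : J, C.a (σ ι) (σ j) = C.a ι j
  noAdj : ∀ (ι : J) (k : ℕ), (σ ^ k) ι ≠ ι → C.a ι ((σ ^ k) ι) ≠ -1

/-- Height function on `(J, σ)`. -/
def IsHeightFunction (C : CartanADE J) (D : DiagAut C) (ξ : J → ℤ) : Prop :=
  (∀ ι j : J, C.a ι j = -1 → orbitSize D.σ ι = orbitSize D.σ j →
      |ξ ι - ξ j| = (orbitSize D.σ ι : ℤ)) ∧
  (∀ ι j : J, C.a ι j = -1 → orbitSize D.σ ι < orbitSize D.σ j →
      ∃! j0 : J, SameOrbit D.σ j j0 ∧ |ξ ι - ξ j0| = 1 ∧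
        ∀ k : ℕ, k < orderOf D.σ → ξ ((D.σ ^ k) j0) = ξ j0 - 2 * (k : ℤ))

/-- Symmetric bilinear form on the root lattice `ℤ^J`. -/
def pairing (C : CartanADE J) (v w : J → ℤ) : ℤ := ∑ ι : J, ∑ j : J, v ι * C.a ι j * w j

/-- Positive roots. -/
def posRoots (C : CartanADE J) : Set (J → ℤ) :=
  {v | (∀ ι : J, 0 ≤ v ι) ∧ v ≠ 0 ∧ pairing C v v = 2}

def simpleRoot (ι : J) : J → ℤ := fun j => if j = ι then 1 else 0

/-- Simple reflection `s_ι` on the root lattice. -/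
def reflS (C : CartanADE J) (ι : J) (v : J → ℤ) : J → ℤ :=
  fun j => v j - (∑ κ : J, v κ * C.a κ ι) * simpleRoot ι j

/-- `applyRefls C [ι₁, …, ι_m] v = s_{ι₁}(s_{ι₂}(⋯ s_{ι_m}(v)⋯))`. -/
def applyRefls (C : CartanADE J) (w : List J) (v : J → ℤ) : J → ℤ :=
  w.foldr (reflS C) v

/-- `β_k = s_{ι₁} ⋯ s_{ι_{k-1}} (α_{ι_k})`. -/
def betaOf (C : CartanADE J) {L : ℕ} (ii : Fin L → J) (k : Fin L) : J → ℤ :=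
  applyRefls C ((List.ofFn ii).take k.1) (simpleRoot (ii k))

/-- `ii` is a reduced word of the longest element. -/
def IsReducedWord (C : CartanADE J) {L : ℕ} (ii : Fin L → J) : Prop :=
  L = (posRoots C).ncard ∧ Function.Injective (betaOf C ii) ∧
    ∀ k : Fin L, betaOf C ii k ∈ posRoots C

def pairingQ (C : CartanADE J) (v w : J → ℚ) : ℚ :=
  ∑ ι : J, ∑ j : J, v ι * (C.a ι j : ℚ) * w j

def reflQ (C : CartanADE J) (ι : J) (v : J → ℚ) : J → ℚ :=
  fun j => v j - (∑ κ : J, v κ * (C.a κ ι : ℚ)) * (if j = ι then 1 else 0)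

def applyReflsQ (C : CartanADE J) (w : List J) (v : J → ℚ) : J → ℚ :=
  w.foldr (reflQ C) v

/-- `Λ` is a system of fundamental weights: `(Λ_ι, α_j) = δ_{ιj}`. -/
def IsFundWeights (C : CartanADE J) (Λ : J → J → ℚ) : Prop :=
  ∀ ι j : J, pairingQ C (Λ ι) (fun κ => (simpleRoot j κ : ℚ)) = if ι = j then 1 else 0

/-- `ν_k = -(s_{ι₁} ⋯ s_{ι_k})(Λ_{ι_k})`. -/
def nuOf (C : CartanADE J) {L : ℕ} (ii : Fin L → J) (Λ : J → J → ℚ) (k : Fin L) : J → ℚ :=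
  - applyReflsQ C ((List.ofFn ii).take (k.1 + 1)) (Λ (ii k))

def betaQ (C : CartanADE J) {L : ℕ} (ii : Fin L → J) (k : Fin L) : J → ℚ :=
  fun j => (betaOf C ii k j : ℚ)

/-- The pairing `(ν_k, β_t)`. -/
def nuBetaPair (C : CartanADE J) {L : ℕ} (ii : Fin L → J) (Λ : J → J → ℚ) (k t : Fin L) : ℚ :=
  pairingQ C (nuOf C ii Λ k) (betaQ C ii t)

/-- `m` is a Kostant partition of `β`. -/
def IsKP (C : CartanADE J) (β : J → ℤ) (m : (J → ℤ) → ℤ) : Prop :=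
  (∀ v : J → ℤ, v ∉ posRoots C → m v = 0) ∧ (∀ v ∈ posRoots C, 0 ≤ m v) ∧
    ∑ᶠ v ∈ posRoots C, m v • v = β

/-- `ρ^ii(m)_r = Σ_{t ≤ r} m(β_t)(ν_r, β_t)`. -/
def rhoOf (C : CartanADE J) {L : ℕ} (ii : Fin L → J) (Λ : J → J → ℚ)
    (m : (J → ℤ) → ℤ) (r : Fin L) : ℚ :=
  ∑ t ∈ Finset.univ.filter (fun t : Fin L => t ≤ r),
    (m (betaOf C ii t) : ℚ) * nuBetaPair C ii Λ r t

/-- The partial order `≼_ii` on Kostant partitions. -/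
def kpLE (C : CartanADE J) {L : ℕ} (ii : Fin L → J) (Λ : J → J → ℚ)
    (m n : (J → ℤ) → ℤ) : Prop :=
  ∀ r : Fin L, rhoOf C ii Λ m r ≤ rhoOf C ii Λ n r

/-- The height function obtained from `ξ` by applying sources `w = [ι₁, …, ι_k]`. -/
noncomputable def heightAfter (σ : Equiv.Perm J) (ξ : J → ℤ) (w : List J) : J → ℤ :=
  w.foldl (fun η ι => fun j => η j - if j = ι then 2 * (orbitSize σ ι : ℤ) else 0) ξ

def IsSource (C : CartanADE J) (ξ : J → ℤ) (ι : J) : Prop :=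
  ∀ j : J, C.a ι j = -1 → ξ j < ξ ι

/-- `ii` is adapted to the Q-datum `(J, σ, ξ)`. -/
def IsAdapted (C : CartanADE J) (D : DiagAut C) (ξ : J → ℤ) {L : ℕ} (ii : Fin L → J) : Prop :=
  ∀ k : Fin L, IsSource C (heightAfter D.σ ξ ((List.ofFn ii).take k.1)) (ii k)

/-- `(s_{ι_{k-1}} ⋯ s_{ι_1} ξ)_{ι_k}`, the second component of `Ω̃_Q(β_k)`. -/
noncomputable def heightAt (σ : Equiv.Perm J) (ξ : J → ℤ) {L : ℕ} (ii : Fin L → J) (k : Fin L) : ℤ :=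
  heightAfter σ ξ ((List.ofFn ii).take k.1) (ii k)

/-- `x ∈ Im Ω̃_Q`. -/
def InImOmega (σ : Equiv.Perm J) (ξ : J → ℤ) {L : ℕ} (ii : Fin L → J) (x : J × ℤ) : Prop :=
  ∃ k : Fin L, ii k = x.1 ∧ heightAt σ ξ ii k = x.2

/-- A single commutation move. -/
def CommStep (C : CartanADE J) {L : ℕ} (ii jj : Fin L → J) : Prop :=
  ∃ (k : ℕ) (h1 : k < L) (h2 : k + 1 < L),
    C.a (ii ⟨k, h1⟩) (ii ⟨k + 1, h2⟩) = 0 ∧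
    jj = ii ∘ Equiv.swap (⟨k, h1⟩ : Fin L) ⟨k + 1, h2⟩

/-- Commutation equivalence of words. -/
def CommEquiv (C : CartanADE J) {L : ℕ} (ii jj : Fin L → J) : Prop :=
  Relation.ReflTransGen (CommStep C) ii jj

/-- The orbits of `ι` and `j` are adjacent (`\barι ∼ \barj` in `I₀`). -/
def adjOrbit (C : CartanADE J) (σ : Equiv.Perm J) (ι j : J) : Prop :=
  ∃ ι' j' : J, SameOrbit σ ι ι' ∧ SameOrbit σ j j' ∧ C.a ι' j' = -1

/-- `c ι j` is the Cartan matrix `c_{\barι \barj}` of the folded algebra `𝔤₀`. -/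
noncomputable def IsFoldedCartan (C : CartanADE J) (σ : Equiv.Perm J) (c : J → J → ℤ) : Prop :=
  ∀ ι j : J, (c ι j : ℚ) =
    if SameOrbit σ ι j then 2
    else if adjOrbit C σ ι j then -(max 1 ((orbitSize σ j : ℚ) / (orbitSize σ ι : ℚ)))
    else 0

/-- The basis element `ϖ_{\barι, p}` of `𝒫_ℤ`, realized as a function on `J × ℤ`
(the indicator of `orbit(ι) × {p}`). -/
noncomputable def varpiF (σ : Equiv.Perm J) (ι : J) (p : ℤ) : (J × ℤ) → ℤ :=
  fun y => if SameOrbit σ ι y.1 ∧ y.2 = p then 1 else 0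

/-- The ℓ-root `α_{\barι, p}`. -/
noncomputable def lrootF (σ : Equiv.Perm J) (c : J → J → ℤ) (ι : J) (p : ℤ) : (J × ℤ) → ℤ :=
  fun y => varpiF σ ι (p + (orbitSize σ ι : ℤ)) y + varpiF σ ι (p - (orbitSize σ ι : ℤ)) y
    - (if (¬ SameOrbit σ ι y.1) ∧
          ∃ k : ℤ, 1 ≤ k ∧ k ≤ -(c y.1 ι) ∧ y.2 = p - c y.1 ι + 1 - 2 * k
       then 1 else 0)

/-- `(\barι, p + 𝗌_{\barι}) ∈ Î₀`, i.e. the index `(\barι,p)` gives a valid ℓ-root. -/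
def ValidLRootIdx (σ : Equiv.Perm J) (ξ : J → ℤ) (ι : J) (p : ℤ) : Prop :=
  (2 : ℤ) ∣ (p + (orbitSize σ ι : ℤ) - ξ ι)

/-- The set of all ℓ-roots (generating `𝒬_ℤ`). -/
noncomputable def lrootSet (σ : Equiv.Perm J) (ξ : J → ℤ) (c : J → J → ℤ) :
    Set ((J × ℤ) → ℤ) :=
  {x | ∃ (ι : J) (p : ℤ), ValidLRootIdx σ ξ ι p ∧ x = lrootF σ c ι p}

/-- The ℤ-linear map `Ω_Q : ℤ^{R⁺} → 𝒫_ℤ`. -/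
noncomputable def OmegaQmap (C : CartanADE J) (σ : Equiv.Perm J) (ξ : J → ℤ) {L : ℕ}
    (ii : Fin L → J) (m : (J → ℤ) → ℤ) : (J × ℤ) → ℤ :=
  ∑ k : Fin L, m (betaOf C ii k) • varpiF σ (ii k) (heightAt σ ξ ii k)

set_option linter.unusedSectionVars false

/-! ### The dual Weyl vector `f` and the shape of the Dynkin diagram -/

lemma exists_weylVec (C : CartanADE J) (Λ : J → J → ℚ) (hΛ : IsFundWeights C Λ) :
    ∃ f : J → ℚ, ∀ j, ∑ κ, f κ * (C.a κ j : ℚ) = 1 := by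
  refine ⟨fun κ => ∑ i, Λ i κ, fun j => ?_⟩
  have h : ∀ i, ∑ κ, Λ i κ * (C.a κ j : ℚ) = if i = j then 1 else 0 := by
    intro i
    rw [← hΛ i j]
    unfold pairingQ simpleRoot
    refine Finset.sum_congr rfl fun κ _ => ?_
    simp
  simp_rw [Finset.sum_mul]
  rw [Finset.sum_comm]
  simp_rw [h]
  simp

lemma eq_zero_of_form_le (C : CartanADE J) (g : J → ℚ)
    (h : ∑ i, ∑ j, g i * (C.a i j : ℚ) * g j ≤ 0) : g = 0 := by
  by_contra hg
  exact absurd (C.posDef g hg) (not_lt.mpr h)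

lemma weylVec_inv (C : CartanADE J) (D : DiagAut C) (f : J → ℚ)
    (hf : ∀ j, ∑ κ, f κ * (C.a κ j : ℚ) = 1) (v : J) : f (D.σ v) = f v := by
  have h1 : ∀ j, ∑ κ, f (D.σ κ) * (C.a κ j : ℚ) = 1 := by
    intro j
    rw [← hf (D.σ j)]
    rw [← Equiv.sum_comp D.σ (fun κ => f κ * (C.a κ (D.σ j) : ℚ))]
    refine Finset.sum_congr rfl fun κ _ => ?_
    rw [D.compat]
  have h2 : (fun κ => f (D.σ κ) - f κ) = 0 := by
    apply eq_zero_of_form_le C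
    rw [Finset.sum_comm]
    refine le_of_eq (Finset.sum_eq_zero fun j _ => ?_)
    rw [← Finset.sum_mul]
    simp_rw [sub_mul, Finset.sum_sub_distrib]
    rw [h1, hf]
    simp
  have := congrFun h2 v
  simp only [Pi.zero_apply] at this
  linarith

lemma weylVec_nonneg (C : CartanADE J) (f : J → ℚ)
    (hf : ∀ j, ∑ κ, f κ * (C.a κ j : ℚ) = 1) (v : J) : 0 ≤ f v := by
  have hg : (fun κ => max 0 (-f κ)) = 0 := by
    apply eq_zero_of_form_le C
    have h1 : ∑ i, ∑ j, f i * (C.a i j : ℚ) * max 0 (-f j) = ∑ j, max 0 (-f j) := by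
      rw [Finset.sum_comm]
      refine Finset.sum_congr rfl fun j _ => ?_
      rw [← Finset.sum_mul, hf, one_mul]
    have h2 : 0 ≤ ∑ j, max 0 (-f j) := Finset.sum_nonneg fun j _ => le_max_left _ _
    have h3 : ∑ i, ∑ j, (max 0 (-f i)) * (C.a i j : ℚ) * max 0 (-f j)
        ≤ ∑ i, ∑ j, -(f i * (C.a i j : ℚ) * max 0 (-f j)) := by
      refine Finset.sum_le_sum fun i _ => Finset.sum_le_sum fun j _ => ?_
      have hj : 0 ≤ max 0 (-f j) := le_max_left _ _
      rcases le_total 0 (f i) with hi | hi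
      · rw [max_eq_left (by linarith : -f i ≤ 0)]
        by_cases hij : i = j
        · subst hij
          rw [max_eq_left (by linarith : -f i ≤ 0)]; simp
        · have ha : (C.a i j : ℚ) ≤ 0 := by
            rcases C.offDiag i j hij with h | h <;> rw [h] <;> norm_num
          have : f i * (C.a i j : ℚ) ≤ 0 := mul_nonpos_of_nonneg_of_nonpos hi ha
          nlinarith
      · rw [max_eq_right (by linarith : 0 ≤ -f i)]
        linarith
    simp_rw [Finset.sum_neg_distrib] at h3
    linarith
  have := congrFun hg v
  simp only [Pi.zero_apply] at this
  have h := le_max_right 0 (-f v)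
  linarith

lemma adj_ne (C : CartanADE J) {i j : J} (h : C.a i j = -1) : i ≠ j := by
  rintro rfl
  rw [C.diag] at h
  omega

lemma upper_unique (C : CartanADE J) (f : J → ℚ)
    (hf : ∀ j, ∑ κ, f κ * (C.a κ j : ℚ) = 1) {v x y : J}
    (hx : C.a v x = -1) (hy : C.a v y = -1) (hfx : f v ≤ f x) (hfy : f v ≤ f y) : x = y := by
  by_contra hxy
  have h0 := weylVec_nonneg C f hf
  have h1 : ∑ κ, f κ * (C.a κ v : ℚ) ≤ ∑ κ, ((if κ = v then 2 * f v else 0)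
      - (if κ = x then f x else 0) - (if κ = y then f y else 0)) := by
    refine Finset.sum_le_sum fun κ _ => ?_
    have hvx := adj_ne C hx
    have hvy := adj_ne C hy
    by_cases hv : κ = v
    · subst hv
      rw [C.diag]; simp [hvx, hvy]; linarith
    by_cases h2 : κ = x
    · subst h2
      rw [C.symm, hx]; simp [hv, hxy]
    by_cases h3 : κ = y
    · subst h3
      rw [C.symm, hy]; simp [hv, h2]
    simp only [hv, h2, h3, if_false]
    have := h0 κ
    rcases C.offDiag κ v hv with h | h <;> rw [h] <;> simp [this]
  rw [hf, Finset.sum_sub_distrib, Finset.sum_sub_distrib] at h1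
  simp at h1
  linarith

/-- A local maximum of the Weyl vector is fixed by the automorphism. -/
lemma localMax_fixed (C : CartanADE J) (D : DiagAut C) (f : J → ℚ)
    (hf : ∀ j, ∑ κ, f κ * (C.a κ j : ℚ) = 1) (v : J)
    (hv : ∀ u, C.a v u = -1 → f u ≤ f v) : D.σ v = v := by
  let R : J → J → Prop := fun x y => C.a x y = -1 ∧ f y ≤ f x
  have hS : {w | Relation.ReflTransGen R v w} = Set.univ := by
    apply C.indec _ ⟨v, Relation.ReflTransGen.refl⟩
    intro w hw y hy
    by_cases hle : f y ≤ f w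
    · exact Relation.ReflTransGen.tail hw ⟨hy, hle⟩
    push Not at hle
    rcases Relation.ReflTransGen.cases_tail hw with h | ⟨x, hx, hxw⟩
    · subst h
      exact absurd (hv y hy) (not_le.mpr hle)
    · have : x = y := upper_unique C f hf (by rw [C.symm]; exact hxw.1) hy hxw.2 hle.le
      subst this
      exact hx
  have hmax : ∀ w, Relation.ReflTransGen R v w → f w ≤ f v := by
    intro w hw
    induction hw with
    | refl => exact le_rfl
    | tail _ h ih => exact h.2.trans ih
  have hkey : ∀ w, Relation.ReflTransGen R v w → f w = f v → w = v ∨ C.a v w = -1 := by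
    intro w hw
    induction hw with
    | refl => intro _; left; rfl
    | @tail x w hx h ih =>
      intro hw
      have hxv : f x = f v := le_antisymm (hmax x hx) (hw ▸ h.2)
      rcases ih hxv with rfl | hvx
      · right; exact h.1
      · left
        exact upper_unique C f hf h.1 (by rw [C.symm]; exact hvx) (by rw [hw, hxv]) (by rw [hxv])
  have hmem : Relation.ReflTransGen R v (D.σ v) := by
    have : D.σ v ∈ {w | Relation.ReflTransGen R v w} := by rw [hS]; trivial
    exact this
  rcases hkey _ hmem (weylVec_inv C D f hf v) with h | h
  · exact h
  · by_contra hne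
    exact D.noAdj v 1 (by simpa using hne) (by simpa using h)

/-! ### Orbits -/

lemma perm_pow_eq_iterate (σ : Equiv.Perm J) (k : ℕ) (v : J) : (σ ^ k) v = (σ^[k]) v := by
  rw [Equiv.Perm.iterate_eq_pow]

lemma orbitSize_eq (σ : Equiv.Perm J) (v : J) :
    orbitSize σ v = Function.minimalPeriod σ v := by
  have hd : 0 < orderOf σ := orderOf_pos σ
  have hper : Function.IsPeriodicPt σ (orderOf σ) v := by
    unfold Function.IsPeriodicPt Function.IsFixedPt
    rw [← perm_pow_eq_iterate, pow_orderOf_eq_one]; rfl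
  have hpos : 0 < Function.minimalPeriod σ v := hper.minimalPeriod_pos hd
  have hle : Function.minimalPeriod σ v ≤ orderOf σ := hper.minimalPeriod_le hd
  unfold orbitSize
  have : (Finset.range (orderOf σ)).image (fun k => (σ ^ k) v)
      = (Finset.range (Function.minimalPeriod σ v)).image (fun k => (σ ^ k) v) := by
    ext w
    simp only [Finset.mem_image, Finset.mem_range]
    constructor
    · rintro ⟨k, _, rfl⟩
      refine ⟨k % Function.minimalPeriod σ v, Nat.mod_lt _ hpos, ?_⟩
      rw [perm_pow_eq_iterate, perm_pow_eq_iterate, Function.iterate_mod_minimalPeriod_eq]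
    · rintro ⟨k, hk, rfl⟩
      exact ⟨k, lt_of_lt_of_le hk hle, rfl⟩
  rw [this, Finset.card_image_of_injOn, Finset.card_range]
  intro a ha b hb hab
  simp only [Finset.coe_range, Set.mem_Iio] at ha hb
  simp only [perm_pow_eq_iterate] at hab
  exact (Function.iterate_eq_iterate_iff_of_lt_minimalPeriod ha hb).1 hab

lemma pow_fix_iff (σ : Equiv.Perm J) (v : J) (k : ℕ) :
    (σ ^ k) v = v ↔ orbitSize σ v ∣ k := by
  rw [orbitSize_eq, perm_pow_eq_iterate]
  exact Function.isPeriodicPt_iff_minimalPeriod_dvd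

lemma orbitSize_pos (σ : Equiv.Perm J) (v : J) : 0 < orbitSize σ v := by
  have h : orbitSize σ v ∣ orderOf σ := (pow_fix_iff σ v _).1 (by rw [pow_orderOf_eq_one]; rfl)
  exact Nat.pos_of_dvd_of_pos h (orderOf_pos σ)

lemma orbitSize_pow (σ : Equiv.Perm J) (v : J) (k : ℕ) :
    orbitSize σ ((σ ^ k) v) = orbitSize σ v := by
  apply Nat.dvd_antisymm
  · rw [← pow_fix_iff, ← Equiv.Perm.mul_apply, ← pow_add, add_comm, pow_add,
      Equiv.Perm.mul_apply, (pow_fix_iff σ v _).2 dvd_rfl]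
  · rw [← pow_fix_iff]
    have := (pow_fix_iff σ ((σ ^ k) v) _).2 dvd_rfl
    rw [← Equiv.Perm.mul_apply, ← pow_add, add_comm, pow_add, Equiv.Perm.mul_apply] at this
    exact (σ ^ k).injective this

lemma orbitSize_same (σ : Equiv.Perm J) {v w : J} (h : SameOrbit σ v w) :
    orbitSize σ w = orbitSize σ v := by
  obtain ⟨k, rfl⟩ := h
  exact orbitSize_pow σ v k

lemma sameOrbit_refl (σ : Equiv.Perm J) (v : J) : SameOrbit σ v v := ⟨0, rfl⟩

lemma sameOrbit_lt (σ : Equiv.Perm J) {v w : J} (h : SameOrbit σ v w) :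
    ∃ k < orderOf σ, (σ ^ k) v = w := by
  obtain ⟨k, rfl⟩ := h
  exact ⟨k % orderOf σ, Nat.mod_lt _ (orderOf_pos σ), by rw [pow_mod_orderOf]⟩

lemma sameOrbit_symm (σ : Equiv.Perm J) {v w : J} (h : SameOrbit σ v w) : SameOrbit σ w v := by
  obtain ⟨k, hk, rfl⟩ := sameOrbit_lt σ h
  refine ⟨orderOf σ - k, ?_⟩
  rw [← Equiv.Perm.mul_apply, ← pow_add, Nat.sub_add_cancel hk.le, pow_orderOf_eq_one]; rfl

lemma sameOrbit_trans (σ : Equiv.Perm J) {u v w : J} (h : SameOrbit σ u v)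
    (h' : SameOrbit σ v w) : SameOrbit σ u w := by
  obtain ⟨k, rfl⟩ := h
  obtain ⟨l, rfl⟩ := h'
  exact ⟨l + k, by rw [pow_add]; rfl⟩

lemma compat_pow (C : CartanADE J) (D : DiagAut C) (k : ℕ) (i j : J) :
    C.a ((D.σ ^ k) i) ((D.σ ^ k) j) = C.a i j := by
  induction k with
  | zero => rfl
  | succ k ih => rw [pow_succ']; simp only [Equiv.Perm.mul_apply]; rw [D.compat, ih]

lemma not_same_of_adj (C : CartanADE J) (D : DiagAut C) {i j : J} (h : C.a i j = -1) :
    ¬ SameOrbit D.σ i j := by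
  rintro ⟨k, rfl⟩
  exact D.noAdj i k (adj_ne C h).symm h

lemma weylVec_inv_pow (C : CartanADE J) (D : DiagAut C) (f : J → ℚ)
    (hf : ∀ j, ∑ κ, f κ * (C.a κ j : ℚ) = 1) (v : J) (k : ℕ) : f ((D.σ ^ k) v) = f v := by
  induction k with
  | zero => rfl
  | succ k ih => rw [pow_succ', Equiv.Perm.mul_apply, weylVec_inv C D f hf, ih]

/-- Going down along the Weyl vector, orbit sizes are multiplied. -/
lemma size_dvd (C : CartanADE J) (D : DiagAut C) (f : J → ℚ)
    (hf : ∀ j, ∑ κ, f κ * (C.a κ j : ℚ) = 1) {u v : J} (huv : C.a v u = -1)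
    (hle : f v ≤ f u) : orbitSize D.σ u ∣ orbitSize D.σ v := by
  rw [← pow_fix_iff]
  set k := orbitSize D.σ v with hk
  have hv : (D.σ ^ k) v = v := (pow_fix_iff _ _ _).2 dvd_rfl
  refine upper_unique C f hf (v := v) ?_ huv ?_ hle
  · conv_lhs => rw [← hv]
    rw [compat_pow, huv]
  · rw [weylVec_inv_pow C D f hf]; exact hle

/-- If adjacent orbits have different sizes, the larger one is free. -/
lemma size_eq_order (C : CartanADE J) (D : DiagAut C) (ξ : J → ℤ)
    (hξ : IsHeightFunction C D ξ) {i j : J} (h : C.a i j = -1)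
    (hlt : orbitSize D.σ i < orbitSize D.σ j) : orbitSize D.σ j = orderOf D.σ := by
  obtain ⟨j0, ⟨h1, h2, h3⟩, -⟩ := hξ.2 i j h hlt
  rw [← orbitSize_same _ h1]
  have hd : orbitSize D.σ j0 ∣ orderOf D.σ :=
    (pow_fix_iff D.σ j0 _).1 (by rw [pow_orderOf_eq_one]; rfl)
  by_contra hne
  have hl := lt_of_le_of_ne (Nat.le_of_dvd (orderOf_pos _) hd) hne
  have := h3 _ hl
  rw [(pow_fix_iff D.σ j0 _).2 dvd_rfl] at this
  have hp := orbitSize_pos D.σ j0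
  omega

/-- Distinct vertices of an orbit have heights distinct modulo twice the orbit size. -/
def OrbSep (σ : Equiv.Perm J) (ξ : J → ℤ) (v : J) : Prop :=
  ∀ w, SameOrbit σ v w → (2 * (orbitSize σ v : ℤ)) ∣ ξ w - ξ v → w = v

lemma structure_lemma (C : CartanADE J) (D : DiagAut C) (ξ : J → ℤ)
    (hξ : IsHeightFunction C D ξ) (f : J → ℚ)
    (hf : ∀ j, ∑ κ, f κ * (C.a κ j : ℚ) = 1) (v : J) :
    (orbitSize D.σ v = 1 ∨ orbitSize D.σ v = orderOf D.σ) ∧ OrbSep D.σ ξ v := by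
  have hwf : WellFounded (fun x y : J => f y < f x) := by
    have : IsStrictOrder J (fun x y : J => f y < f x) :=
      { irrefl := fun a => lt_irrefl _
        trans := fun a b c h1 h2 => h2.trans h1 }
    exact Finite.wellFounded_of_trans_of_irrefl _
  induction v using hwf.induction with
  | _ v ih =>
  by_cases hv : ∀ u, C.a v u = -1 → f u ≤ f v
  · have hfix := localMax_fixed C D f hf v hv
    have hs : orbitSize D.σ v = 1 := by
      have := (pow_fix_iff D.σ v 1).1 (by simpa using hfix)
      exact Nat.dvd_one.1 this
    refine ⟨Or.inl hs, ?_⟩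
    rintro w ⟨k, rfl⟩ _
    rw [pow_fix_iff, hs]; exact one_dvd _
  · push Not at hv
    obtain ⟨u, huv, hlt⟩ := hv
    obtain ⟨hu1, hu2⟩ := ih u hlt
    have hdv := size_dvd C D f hf huv hlt.le
    rcases (Nat.le_of_dvd (orbitSize_pos _ _) hdv).lt_or_eq with h | h
    · have hadj : C.a u v = -1 := by rw [C.symm]; exact huv
      have hs := size_eq_order C D ξ hξ hadj h
      refine ⟨Or.inr hs, ?_⟩
      obtain ⟨j0, ⟨h1, h2, h3⟩, -⟩ := hξ.2 u v hadj h
      intro w hw hdw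
      obtain ⟨a, ha, rfl⟩ := sameOrbit_lt D.σ (sameOrbit_symm _ h1)
      obtain ⟨b, hb, rfl⟩ := sameOrbit_lt D.σ
        (sameOrbit_trans _ (sameOrbit_symm _ h1) hw)
      rw [h3 a ha, h3 b hb, hs] at hdw
      obtain ⟨q, hq⟩ := hdw
      have hq' : (a : ℤ) - b = orderOf D.σ * q := by linarith
      have : q = 0 := by
        by_contra hq0
        rcases lt_or_gt_of_ne hq0 with h | h
        · have : (orderOf D.σ : ℤ) * q ≤ -(orderOf D.σ : ℤ) := by nlinarith
          omega
        · have : (orderOf D.σ : ℤ) * q ≥ (orderOf D.σ : ℤ) := by nlinarith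
          omega
      rw [this] at hq'
      have : a = b := by omega
      rw [this]
    · refine ⟨by rw [← h]; exact hu1, ?_⟩
      rintro w ⟨k, rfl⟩ hdw
      rw [pow_fix_iff, ← h, ← pow_fix_iff]
      apply hu2 _ ⟨k, rfl⟩
      have e1 := hξ.1 v u huv h.symm
      have e2 := hξ.1 ((D.σ ^ k) v) ((D.σ ^ k) u) (by rw [compat_pow, huv])
        (by rw [orbitSize_pow, orbitSize_pow, h])
      rw [orbitSize_pow] at e2
      rw [h]
      have hpos : (0:ℤ) ≤ orbitSize D.σ v := by positivity
      obtain ⟨q, hq⟩ := hdw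
      rcases (abs_eq hpos).1 e1 with e1 | e1 <;> rcases (abs_eq hpos).1 e2 with e2 | e2
      · exact ⟨q, by linarith⟩
      · exact ⟨q + 1, by linarith⟩
      · exact ⟨q - 1, by linarith⟩
      · exact ⟨q, by linarith⟩

/-- The sizes of adjacent orbits: the smaller one is a fixed point. -/
lemma small_eq_one (C : CartanADE J) (D : DiagAut C) (ξ : J → ℤ)
    (hξ : IsHeightFunction C D ξ) (f : J → ℚ)
    (hf : ∀ j, ∑ κ, f κ * (C.a κ j : ℚ) = 1) {i j : J} (h : C.a i j = -1)
    (hlt : orbitSize D.σ i < orbitSize D.σ j) : orbitSize D.σ i = 1 := by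
  rcases (structure_lemma C D ξ hξ f hf i).1 with h1 | h1
  · exact h1
  · rw [size_eq_order C D ξ hξ h hlt] at hlt
    omega

/-! ### Evolution of the heights -/

/-- The height function after `τ` steps. -/
noncomputable def hgt (σ : Equiv.Perm J) (ξ : J → ℤ) {L : ℕ} (ii : Fin L → J) (τ : ℕ) : J → ℤ :=
  heightAfter σ ξ ((List.ofFn ii).take τ)

lemma take_succ_ofFn {L : ℕ} (ii : Fin L → J) (t : Fin L) :
    (List.ofFn ii).take (t.1 + 1) = (List.ofFn ii).take t.1 ++ [ii t] := by
  rw [List.take_add_one]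
  simp

lemma hgt_succ (σ : Equiv.Perm J) (ξ : J → ℤ) {L : ℕ} (ii : Fin L → J) (t : Fin L) (j : J) :
    hgt σ ξ ii (t.1 + 1) j
      = hgt σ ξ ii t.1 j - if j = ii t then 2 * (orbitSize σ (ii t) : ℤ) else 0 := by
  unfold hgt heightAfter
  rw [take_succ_ofFn, List.foldl_append]
  rfl

lemma hgt_ge (σ : Equiv.Perm J) (ξ : J → ℤ) {L : ℕ} (ii : Fin L → J) (t : ℕ) (ht : L ≤ t) :
    hgt σ ξ ii (t + 1) = hgt σ ξ ii t := by
  unfold hgt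
  rw [List.take_of_length_le (by rw [List.length_ofFn]; omega),
    List.take_of_length_le (by rw [List.length_ofFn]; omega)]

lemma hgt_antitone (σ : Equiv.Perm J) (ξ : J → ℤ) {L : ℕ} (ii : Fin L → J) (j : J)
    {a b : ℕ} (hab : a ≤ b) : hgt σ ξ ii b j ≤ hgt σ ξ ii a j := by
  induction b, hab using Nat.le_induction with
  | base => exact le_rfl
  | succ b _ ih =>
    refine le_trans ?_ ih
    by_cases hb : b < L
    · have := hgt_succ σ ξ ii ⟨b, hb⟩ j
      simp only at this
      rw [this]
      split_ifs <;> omega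
    · rw [hgt_ge σ ξ ii b (by omega)]

lemma hgt_drop (σ : Equiv.Perm J) (ξ : J → ℤ) {L : ℕ} (ii : Fin L → J) (t : Fin L)
    {b : ℕ} (hab : t.1 < b) :
    hgt σ ξ ii b (ii t) ≤ hgt σ ξ ii t.1 (ii t) - 2 * (orbitSize σ (ii t) : ℤ) := by
  refine (hgt_antitone σ ξ ii (ii t) (Nat.succ_le_of_lt hab)).trans ?_
  rw [Nat.succ_eq_add_one, hgt_succ]
  simp

lemma hgt_congr (σ : Equiv.Perm J) (ξ : J → ℤ) {L : ℕ} (ii : Fin L → J) (τ : ℕ) (j : J) :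
    (2 * (orbitSize σ j : ℤ)) ∣ hgt σ ξ ii τ j - ξ j := by
  induction τ with
  | zero => simp [hgt, heightAfter]
  | succ b ih =>
    by_cases hb : b < L
    · have := hgt_succ σ ξ ii ⟨b, hb⟩ j
      simp only at this
      rw [this]
      split_ifs with h
      · rw [← h]
        have : hgt σ ξ ii b j - 2 * (orbitSize σ j : ℤ) - ξ j
          = (hgt σ ξ ii b j - ξ j) - 2 * (orbitSize σ j : ℤ) := by ring
        rw [this]
        exact dvd_sub ih dvd_rfl
      · simpa using ih
    · rw [hgt_ge σ ξ ii b (by omega)]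
      exact ih

lemma hgt_sep (σ : Equiv.Perm J) (ξ : J → ℤ) {L : ℕ} (ii : Fin L → J) (v : J)
    (hv : OrbSep σ ξ v) (w : J) (hw : SameOrbit σ v w) (a b : ℕ)
    (h : (2 * (orbitSize σ v : ℤ)) ∣ hgt σ ξ ii a w - hgt σ ξ ii b v) : w = v := by
  apply hv w hw
  have h1 := hgt_congr σ ξ ii a w
  have h2 := hgt_congr σ ξ ii b v
  rw [orbitSize_same σ hw] at h1
  have : ξ w - ξ v = (hgt σ ξ ii a w - hgt σ ξ ii b v) - (hgt σ ξ ii a w - ξ w)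
    + (hgt σ ξ ii b v - ξ v) := by ring
  rw [this]
  exact dvd_add (dvd_sub h h1) h2

/-- Local relation between the heights of adjacent vertices. -/
def EdgeInv (C : CartanADE J) (σ : Equiv.Perm J) (η : J → ℤ) : Prop :=
  ∀ i j, C.a i j = -1 →
    (orbitSize σ i = orbitSize σ j → |η i - η j| = (orbitSize σ i : ℤ)) ∧
    (orbitSize σ i < orbitSize σ j →
      ∃ q : ℤ, 0 ≤ q ∧ q ≤ orbitSize σ j ∧ η j - η i = 1 - 2 * q)

lemma edgeInv_init (C : CartanADE J) (D : DiagAut C) (ξ : J → ℤ)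
    (hξ : IsHeightFunction C D ξ) : EdgeInv C D.σ ξ := by
  intro i j h
  refine ⟨hξ.1 i j h, fun hlt => ?_⟩
  have hs := size_eq_order C D ξ hξ h hlt
  obtain ⟨j0, ⟨h1, h2, h3⟩, -⟩ := hξ.2 i j h hlt
  obtain ⟨a, ha, rfl⟩ := sameOrbit_lt D.σ (sameOrbit_symm _ h1)
  rw [h3 a ha, hs]
  rcases (abs_eq (by norm_num)).1 h2 with e | e
  · exact ⟨a + 1, by omega, by omega, by omega⟩
  · exact ⟨a, by omega, by omega, by omega⟩

lemma edgeInv_step (C : CartanADE J) (σ : Equiv.Perm J) (η η' : J → ℤ) (κ : J)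
    (hone : ∀ i j, C.a i j = -1 → orbitSize σ i < orbitSize σ j → orbitSize σ i = 1)
    (h : EdgeInv C σ η) (hs : IsSource C η κ)
    (hη : ∀ j, η' j = η j - if j = κ then 2 * (orbitSize σ κ : ℤ) else 0) :
    EdgeInv C σ η' := by
  intro i j hij
  obtain ⟨h1, h2⟩ := h i j hij
  have hne := adj_ne C hij
  constructor
  · intro heq
    have e := h1 heq
    have hpos : (0:ℤ) ≤ orbitSize σ i := by positivity
    rw [hη i, hη j]
    by_cases hi : i = κ
    · subst hi
      have hlt := hs j hij
      rw [if_pos rfl, if_neg hne.symm]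
      rw [abs_eq hpos] at e ⊢
      omega
    · by_cases hj : j = κ
      · subst hj
        have hlt := hs i (by rw [C.symm]; exact hij)
        rw [if_neg hi, if_pos rfl]
        rw [abs_eq hpos] at e ⊢
        omega
      · rw [if_neg hi, if_neg hj]
        simpa using e
  · intro hlt'
    have ho := hone i j hij hlt'
    obtain ⟨q, hq0, hq1, hq⟩ := h2 hlt'
    rw [hη i, hη j]
    by_cases hi : i = κ
    · subst hi
      have hlt := hs j hij
      rw [if_pos rfl, if_neg hne.symm]
      exact ⟨q - 1, by omega, by omega, by omega⟩
    · by_cases hj : j = κ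
      · subst hj
        have hlt := hs i (by rw [C.symm]; exact hij)
        rw [if_neg hi, if_pos rfl]
        exact ⟨q + orbitSize σ j, by omega, by omega, by omega⟩
      · rw [if_neg hi, if_neg hj]
        exact ⟨q, hq0, hq1, by omega⟩

lemma edgeInv_hgt (C : CartanADE J) (D : DiagAut C) (ξ : J → ℤ)
    (hξ : IsHeightFunction C D ξ)
    (hone : ∀ i j, C.a i j = -1 → orbitSize D.σ i < orbitSize D.σ j → orbitSize D.σ i = 1)
    {L : ℕ} (ii : Fin L → J) (ha : IsAdapted C D ξ ii) (τ : ℕ) :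
    EdgeInv C D.σ (hgt D.σ ξ ii τ) := by
  induction τ with
  | zero => simpa [hgt, heightAfter] using edgeInv_init C D ξ hξ
  | succ b ih =>
    by_cases hb : b < L
    · exact edgeInv_step C D.σ _ _ (ii ⟨b, hb⟩) hone ih (ha ⟨b, hb⟩)
        (hgt_succ D.σ ξ ii ⟨b, hb⟩)
    · rw [hgt_ge D.σ ξ ii b (by omega)]
      exact ih

/-- The heights at which `ι` has height `p - s`. -/
lemma hgt_window (σ : Equiv.Perm J) (ξ : J → ℤ) {L : ℕ} (ii : Fin L → J) (ι : J) (p : ℤ)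
    (k0 k1 : Fin L) (h0 : ii k0 = ι) (h1 : ii k1 = ι)
    (e0 : hgt σ ξ ii k0.1 ι = p + orbitSize σ ι) (e1 : hgt σ ξ ii k1.1 ι = p - orbitSize σ ι)
    (τ : ℕ) : hgt σ ξ ii τ ι = p - orbitSize σ ι ↔ k0.1 < τ ∧ τ ≤ k1.1 := by
  have hpos := orbitSize_pos σ ι
  constructor
  · intro h
    constructor
    · by_contra hc
      have := hgt_antitone σ ξ ii ι (not_lt.1 hc)
      omega
    · by_contra hc
      have := hgt_drop σ ξ ii k1 (not_le.1 hc)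
      rw [h1] at this
      omega
  · rintro ⟨ha, hb⟩
    have h2 := hgt_antitone σ ξ ii ι hb
    have h3 := hgt_drop σ ξ ii k0 ha
    rw [h0] at h3
    omega

/-- Two times with the same letter and the same height coincide. -/
lemma time_unique (σ : Equiv.Perm J) (ξ : J → ℤ) {L : ℕ} (ii : Fin L → J) (s t : Fin L)
    (h : ii s = ii t) (e : hgt σ ξ ii s.1 (ii s) = hgt σ ξ ii t.1 (ii t)) : s = t := by
  have hpos := orbitSize_pos σ (ii s)
  rcases lt_trichotomy s.1 t.1 with hl | hl | hl
  · have := hgt_drop σ ξ ii s hl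
    rw [← h] at e
    omega
  · exact Fin.ext hl
  · have := hgt_drop σ ξ ii t hl
    rw [h] at e hpos
    omega

/-! ### The coefficients of the `ℓ`-root -/

lemma eq_of_window {d x y N : ℤ} (h : x - y = 2 * d * N)
    (h1 : -(2 * d) < x - y) (h2 : x - y < 2 * d) : x = y := by
  have hd : 0 < d := by omega
  have : N = 0 := by
    by_contra hq0
    rcases lt_or_gt_of_ne hq0 with h' | h'
    · have : d * N ≤ -d := by nlinarith
      nlinarith
    · have : d * N ≥ d := by nlinarith
      nlinarith
  rw [this] at h
  omega

/-- The coefficient of the ℓ-root at a vertex outside of the orbit of `ι`. -/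
lemma offOrbit_iff (C : CartanADE J) (D : DiagAut C) (ξ : J → ℤ)
    (hone : ∀ i j, C.a i j = -1 → orbitSize D.σ i < orbitSize D.σ j → orbitSize D.σ i = 1)
    (hsep : ∀ v, OrbSep D.σ ξ v)
    (c : J → J → ℤ) (hc : IsFoldedCartan C D.σ c)
    {L : ℕ} (ii : Fin L → J) (ha : IsAdapted C D ξ ii)
    (hE : ∀ τ, EdgeInv C D.σ (hgt D.σ ξ ii τ))
    (ι : J) (p : ℤ) (k0 k1 : Fin L) (h0 : ii k0 = ι) (h1 : ii k1 = ι)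
    (e0 : hgt D.σ ξ ii k0.1 ι = p + orbitSize D.σ ι)
    (e1 : hgt D.σ ξ ii k1.1 ι = p - orbitSize D.σ ι) (t : Fin L) :
    ((¬ SameOrbit D.σ ι (ii t)) ∧ ∃ k : ℤ, 1 ≤ k ∧ k ≤ -(c (ii t) ι) ∧
        hgt D.σ ξ ii t.1 (ii t) = p - c (ii t) ι + 1 - 2 * k)
      ↔ k0.1 < t.1 ∧ t.1 < k1.1 ∧ C.a (ii t) ι = -1 := by
  have hwin := hgt_window D.σ ξ ii ι p k0 k1 h0 h1 e0 e1
  have hsrc : ∀ j, C.a (ii t) j = -1 → hgt D.σ ξ ii t.1 j < hgt D.σ ξ ii t.1 (ii t) := ha t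
  have hmod : (2 * (orbitSize D.σ ι : ℤ)) ∣ hgt D.σ ξ ii t.1 ι - (p - orbitSize D.σ ι) := by
    rw [← e1]
    have := dvd_sub (hgt_congr D.σ ξ ii t.1 ι) (hgt_congr D.σ ξ ii k1.1 ι)
    simpa using this
  have hin : hgt D.σ ξ ii t.1 ι = p - orbitSize D.σ ι → C.a (ii t) ι = -1 →
      k0.1 < t.1 ∧ t.1 < k1.1 ∧ C.a (ii t) ι = -1 := by
    intro h hadj
    obtain ⟨g1, g2⟩ := (hwin t.1).1 h
    refine ⟨g1, lt_of_le_of_ne g2 ?_, hadj⟩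
    intro hc
    have : t = k1 := Fin.ext hc
    rw [this, h1] at hadj
    exact adj_ne C hadj rfl
  set η := hgt D.σ ξ ii t.1 with hη
  -- the value of `c` at an adjacent pair of vertices
  have hcval : adjOrbit C D.σ (ii t) ι → ¬ SameOrbit D.σ ι (ii t) → (c (ii t) ι : ℚ)
      = -(max 1 ((orbitSize D.σ ι : ℚ) / (orbitSize D.σ (ii t) : ℚ))) := by
    intro hadj hns
    rw [hc, if_neg (fun h => hns (sameOrbit_symm _ h)), if_pos hadj]
  have hsp := orbitSize_pos D.σ (ii t)
  have hcle : adjOrbit C D.σ (ii t) ι → ¬ SameOrbit D.σ ι (ii t) →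
      orbitSize D.σ ι ≤ orbitSize D.σ (ii t) → c (ii t) ι = -1 := by
    intro hadj hns hle
    have := hcval hadj hns
    rw [max_eq_left] at this
    · exact_mod_cast this
    · rw [div_le_one (by exact_mod_cast hsp)]
      exact_mod_cast hle
  have hcgt : adjOrbit C D.σ (ii t) ι → ¬ SameOrbit D.σ ι (ii t) →
      orbitSize D.σ (ii t) = 1 → c (ii t) ι = -(orbitSize D.σ ι : ℤ) := by
    intro hadj hns hle
    have := hcval hadj hns
    rw [hle, Nat.cast_one, div_one, max_eq_right] at this
    · exact_mod_cast this
    · exact_mod_cast orbitSize_pos D.σ ι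
  constructor
  · rintro ⟨hns, k, hk1, hk2, hk⟩
    have hadjO : adjOrbit C D.σ (ii t) ι := by
      by_contra hno
      have := hc (ii t) ι
      rw [if_neg (fun h => hns (sameOrbit_symm _ h)), if_neg hno] at this
      have : c (ii t) ι = 0 := by exact_mod_cast this
      omega
    -- a vertex of the orbit of `ι` adjacent to `ii t`
    obtain ⟨a, b, ha1, hb1, hab⟩ := hadjO
    have hadjO : adjOrbit C D.σ (ii t) ι := ⟨a, b, ha1, hb1, hab⟩
    obtain ⟨ι', hι', hadj⟩ : ∃ ι', SameOrbit D.σ ι ι' ∧ C.a (ii t) ι' = -1 := by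
      obtain ⟨n, hn⟩ := sameOrbit_symm _ ha1
      refine ⟨(D.σ ^ n) b, sameOrbit_trans _ hb1 ⟨n, rfl⟩, ?_⟩
      rw [← hn, compat_pow, hab]
    have hss := orbitSize_same D.σ hι'
    have hlt := hsrc ι' hadj
    rcases lt_trichotomy (orbitSize D.σ ι) (orbitSize D.σ (ii t)) with hsz | hsz | hsz
    · have hadj' : C.a ι' (ii t) = -1 := by rw [C.symm]; exact hadj
      have hιone := hone ι' (ii t) hadj' (by rw [hss]; exact hsz)
      have hfix : ι' = ι := by
        obtain ⟨n, rfl⟩ := hι'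
        rw [pow_fix_iff, ← hss, hιone]
        exact one_dvd _
      subst hfix
      obtain ⟨q, hq0, hq1, hq⟩ := (hE t.1 ι' (ii t) hadj').2 hsz
      have hc1 := hcle hadjO hns hsz.le
      rw [hc1] at hk hk2
      apply hin _ hadj
      rw [← hη] at hq
      rw [hιone]
      push_cast
      omega
    · have hc1 := hcle hadjO hns hsz.le
      rw [hc1] at hk hk2
      have := (hE t.1 (ii t) ι' hadj).1 (by rw [hss, hsz])
      rw [← hη, abs_of_pos (by omega)] at this
      have hv : η ι' = p - orbitSize D.σ ι := by omega
      have hfix : ι' = ι := by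
        refine hgt_sep D.σ ξ ii ι (hsep ι) ι' hι' t.1 k1.1 ?_
        rw [e1, ← hη, hv]; simp
      subst hfix
      exact hin hv hadj
    · have hjone := hone (ii t) ι' hadj (by rw [hss]; exact hsz)
      have hadj2 : C.a (ii t) ι = -1 := by
        obtain ⟨n, hn⟩ := sameOrbit_symm _ hι'
        have hfix : (D.σ ^ n) (ii t) = ii t := by
          rw [pow_fix_iff, hjone]; exact one_dvd _
        rw [← hn, ← hfix, compat_pow, hadj]
      have hlt2 := hsrc ι hadj2
      obtain ⟨q, hq0, hq1, hq⟩ := (hE t.1 (ii t) ι hadj2).2 hsz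
      rw [← hη] at hq
      have hc1 := hcgt hadjO hns hjone
      rw [hc1] at hk hk2
      apply hin _ hadj2
      obtain ⟨N, hN⟩ := hmod
      apply eq_of_window hN <;> omega
  · rintro ⟨g1, g2, hadj⟩
    have hadj' : C.a ι (ii t) = -1 := by rw [C.symm]; exact hadj
    have hns := not_same_of_adj C D hadj'
    have hadjO : adjOrbit C D.σ (ii t) ι :=
      ⟨ii t, ι, sameOrbit_refl _ _, sameOrbit_refl _ _, hadj⟩
    have hval := (hwin t.1).2 ⟨g1, g2.le⟩
    rw [← hη] at hval
    have hlt := hsrc ι hadj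
    refine ⟨hns, ?_⟩
    rcases lt_trichotomy (orbitSize D.σ ι) (orbitSize D.σ (ii t)) with hsz | hsz | hsz
    · have hιone := hone ι (ii t) hadj' hsz
      obtain ⟨q, hq0, hq1, hq⟩ := (hE t.1 ι (ii t) hadj').2 hsz
      rw [← hη] at hq
      rw [hcle hadjO hns hsz.le]
      rw [hιone] at hval
      exact ⟨1, by omega, by omega, by push_cast at hval; omega⟩
    · have := (hE t.1 (ii t) ι hadj).1 hsz.symm
      rw [← hη, abs_of_pos (by omega)] at this
      rw [hcle hadjO hns hsz.le]
      exact ⟨1, by omega, by omega, by omega⟩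
    · have hjone := hone (ii t) ι hadj hsz
      obtain ⟨q, hq0, hq1, hq⟩ := (hE t.1 (ii t) ι hadj).2 hsz
      rw [← hη] at hq
      rw [hcgt hadjO hns hjone]
      exact ⟨orbitSize D.σ ι + 1 - q, by omega, by omega, by omega⟩

/-- The coefficients of `m`. -/
lemma coeff_m (C : CartanADE J) (D : DiagAut C) (ξ : J → ℤ)
    (hone : ∀ i j, C.a i j = -1 → orbitSize D.σ i < orbitSize D.σ j → orbitSize D.σ i = 1)
    (hsep : ∀ v, OrbSep D.σ ξ v)
    (c : J → J → ℤ) (hc : IsFoldedCartan C D.σ c)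
    {L : ℕ} (ii : Fin L → J) (ha : IsAdapted C D ξ ii)
    (hE : ∀ τ, EdgeInv C D.σ (hgt D.σ ξ ii τ))
    (ι : J) (p : ℤ) (k0 k1 : Fin L) (h0 : ii k0 = ι) (h1 : ii k1 = ι)
    (e0 : hgt D.σ ξ ii k0.1 ι = p + orbitSize D.σ ι)
    (e1 : hgt D.σ ξ ii k1.1 ι = p - orbitSize D.σ ι)
    (m : (J → ℤ) → ℤ) (hmeq : OmegaQmap C D.σ ξ ii m = lrootF D.σ c ι p) (t : Fin L) :
    m (betaOf C ii t) = (if t.1 = k0.1 then 1 else 0) + (if t.1 = k1.1 then 1 else 0)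
      - (if k0.1 < t.1 ∧ t.1 < k1.1 ∧ C.a (ii t) ι = -1 then 1 else 0) := by
  have hpos := orbitSize_pos D.σ ι
  have hat : ∀ s, heightAt D.σ ξ ii s = hgt D.σ ξ ii s.1 (ii s) := fun s => rfl
  have h := congrFun hmeq (ii t, heightAt D.σ ξ ii t)
  have hL : OmegaQmap C D.σ ξ ii m (ii t, heightAt D.σ ξ ii t) = m (betaOf C ii t) := by
    unfold OmegaQmap
    rw [Finset.sum_apply, Finset.sum_eq_single t]
    · simp [varpiF, sameOrbit_refl]
    · intro s _ hs
      simp only [Pi.smul_apply, varpiF, smul_eq_mul, mul_ite, mul_one, mul_zero]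
      rw [if_neg]
      rintro ⟨hso, heq⟩
      apply hs
      rw [hat, hat] at heq
      have : ii t = ii s := hgt_sep D.σ ξ ii (ii s) (hsep _) (ii t) hso t.1 s.1 (by simp [heq])
      exact time_unique D.σ ξ ii s t this.symm heq.symm
    · intro hn
      exact absurd (Finset.mem_univ t) hn
  rw [hL] at h
  rw [h]
  have hv : ∀ (κ : Fin L) (x : ℤ), ii κ = ι → hgt D.σ ξ ii κ.1 ι = x →
      varpiF D.σ ι x (ii t, heightAt D.σ ξ ii t) = if t.1 = κ.1 then 1 else 0 := by
    intro κ x hκ hx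
    unfold varpiF
    refine if_congr ?_ rfl rfl
    constructor
    · rintro ⟨hso, heq⟩
      simp only at hso heq
      rw [hat] at heq
      have : ii t = ι := hgt_sep D.σ ξ ii ι (hsep _) (ii t) hso t.1 κ.1 (by simp [heq, hx])
      rw [time_unique D.σ ξ ii t κ (by rw [this, hκ]) (by rw [heq, hκ, hx])]
    · intro he
      have : t = κ := Fin.ext he
      subst this
      simp only [hat]
      rw [hκ]
      exact ⟨sameOrbit_refl _ _, hx⟩
  unfold lrootF
  rw [hv k0 _ h0 e0, hv k1 _ h1 e1]
  congr 1
  exact if_congr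
    (offOrbit_iff C D ξ hone hsep c hc ii ha hE ι p k0 k1 h0 h1 e0 e1 t) rfl rfl

/-! ### Pairings -/

/-- The simple root in the rational space. -/
def rt (i : J) : J → ℚ := fun κ => (simpleRoot i κ : ℚ)

lemma pair_rt (C : CartanADE J) (v : J → ℚ) (j : J) :
    pairingQ C v (rt j) = ∑ κ, v κ * (C.a κ j : ℚ) := by
  unfold pairingQ rt simpleRoot
  refine Finset.sum_congr rfl fun κ _ => ?_
  simp

lemma pair_rt_rt (C : CartanADE J) (i j : J) : pairingQ C (rt i) (rt j) = C.a i j := by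
  rw [pair_rt]
  simp [rt, simpleRoot]

lemma pair_comm (C : CartanADE J) (v w : J → ℚ) : pairingQ C v w = pairingQ C w v := by
  unfold pairingQ
  rw [Finset.sum_comm]
  refine Finset.sum_congr rfl fun i _ => Finset.sum_congr rfl fun j _ => ?_
  rw [C.symm]; ring

lemma pair_sub_smul (C : CartanADE J) (v w u : J → ℚ) (x : ℚ) :
    pairingQ C (fun j => v j - x * w j) u = pairingQ C v u - x * pairingQ C w u := by
  unfold pairingQ
  simp_rw [Finset.mul_sum, ← Finset.sum_sub_distrib]
  refine Finset.sum_congr rfl fun i _ => Finset.sum_congr rfl fun j _ => ?_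
  ring

lemma pair_neg (C : CartanADE J) (v u : J → ℚ) :
    pairingQ C (-v) u = - pairingQ C v u := by
  unfold pairingQ
  simp_rw [← Finset.sum_neg_distrib]
  refine Finset.sum_congr rfl fun i _ => Finset.sum_congr rfl fun j _ => ?_
  simp

lemma reflQ_eq (C : CartanADE J) (i : J) (v : J → ℚ) :
    reflQ C i v = fun j => v j - pairingQ C v (rt i) * rt i j := by
  funext j
  rw [pair_rt]
  unfold reflQ rt simpleRoot
  by_cases h : j = i <;> simp [h]

lemma pair_reflQ_left (C : CartanADE J) (i : J) (v u : J → ℚ) :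
    pairingQ C (reflQ C i v) u = pairingQ C v u - pairingQ C v (rt i) * pairingQ C (rt i) u := by
  rw [reflQ_eq, pair_sub_smul]

lemma pair_reflQ (C : CartanADE J) (i : J) (v w : J → ℚ) :
    pairingQ C (reflQ C i v) (reflQ C i w) = pairingQ C v w := by
  rw [pair_reflQ_left, pair_comm C v, pair_comm C (rt i), pair_reflQ_left, pair_reflQ_left,
    pair_rt_rt, C.diag, pair_comm C w v, pair_comm C (rt i) v]
  push_cast
  ring

lemma pair_applyReflsQ (C : CartanADE J) (l : List J) (v w : J → ℚ) :
    pairingQ C (applyReflsQ C l v) (applyReflsQ C l w) = pairingQ C v w := by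
  induction l with
  | nil => rfl
  | cons i l ih =>
    change pairingQ C (reflQ C i (applyReflsQ C l v)) (reflQ C i (applyReflsQ C l w)) = _
    rw [pair_reflQ, ih]

lemma applyReflsQ_append (C : CartanADE J) (l l' : List J) (v : J → ℚ) :
    applyReflsQ C (l ++ l') v = applyReflsQ C l (applyReflsQ C l' v) := by
  unfold applyReflsQ
  rw [List.foldr_append]

lemma cast_reflS (C : CartanADE J) (i : J) (v : J → ℤ) :
    (fun j => (reflS C i v j : ℚ)) = reflQ C i (fun j => (v j : ℚ)) := by
  funext j
  unfold reflS reflQ simpleRoot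
  push_cast
  by_cases h : j = i <;> simp [h]

lemma cast_applyRefls (C : CartanADE J) (l : List J) (v : J → ℤ) :
    (fun j => (applyRefls C l v j : ℚ)) = applyReflsQ C l (fun j => (v j : ℚ)) := by
  induction l with
  | nil => rfl
  | cons i l ih =>
    change (fun j => (reflS C i (applyRefls C l v) j : ℚ)) = reflQ C i (applyReflsQ C l _)
    rw [cast_reflS, ih]

lemma betaQ_eq (C : CartanADE J) {L : ℕ} (ii : Fin L → J) (t : Fin L) :
    betaQ C ii t = applyReflsQ C ((List.ofFn ii).take t.1) (rt (ii t)) :=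
  cast_applyRefls C _ _

/-- `s_{τ} ⋯ s_{k} Λ`, where `τ` and `k` are positions in the word. -/
def tailVec (C : CartanADE J) {L : ℕ} (ii : Fin L → J) (v : J → ℚ) (k τ : ℕ) : J → ℚ :=
  applyReflsQ C (((List.ofFn ii).take (k + 1)).drop τ) v

lemma tailVec_end (C : CartanADE J) {L : ℕ} (ii : Fin L → J) (v : J → ℚ) (k : ℕ) :
    tailVec C ii v k (k + 1) = v := by
  unfold tailVec
  rw [List.drop_eq_nil_of_le (by simp)]
  rfl

lemma tailVec_step (C : CartanADE J) {L : ℕ} (ii : Fin L → J) (v : J → ℚ) (k : ℕ) (t : Fin L)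
    (h : t.1 ≤ k) :
    tailVec C ii v k t.1 = reflQ C (ii t) (tailVec C ii v k (t.1 + 1)) := by
  unfold tailVec
  have ht := t.2
  rw [List.drop_eq_getElem_cons (by simp; omega)]
  simp [applyReflsQ]

lemma nuBetaPair_eq (C : CartanADE J) {L : ℕ} (ii : Fin L → J) (Λ : J → J → ℚ) (k t : Fin L)
    (h : t ≤ k) :
    nuBetaPair C ii Λ k t = pairingQ C (tailVec C ii (Λ (ii k)) k.1 (t.1 + 1)) (rt (ii t)) := by
  have h' : t.1 ≤ k.1 := h
  unfold nuBetaPair nuOf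
  rw [pair_neg, betaQ_eq]
  have e : (List.ofFn ii).take (k.1 + 1)
      = (List.ofFn ii).take t.1 ++ ((List.ofFn ii).take (k.1 + 1)).drop t.1 := by
    conv_lhs => rw [← List.take_append_drop t.1 ((List.ofFn ii).take (k.1 + 1))]
    rw [List.take_take, min_eq_left (by omega)]
  rw [e, applyReflsQ_append, pair_applyReflsQ]
  change - pairingQ C (tailVec C ii (Λ (ii k)) k.1 t.1) (rt (ii t)) = _
  rw [tailVec_step C ii _ _ _ h', pair_reflQ_left, pair_rt_rt, C.diag]
  push_cast
  ring

lemma sum_fin_le {L : ℕ} (k : Fin L) (g : ℕ → ℚ) :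
    ∑ t ∈ Finset.univ.filter (fun t : Fin L => t ≤ k), g t.1
      = ∑ n ∈ Finset.range (k.1 + 1), g n := by
  symm
  refine Finset.sum_bij' (fun n hn => (⟨n, by have := k.2; simp at hn; omega⟩ : Fin L))
    (fun t _ => t.1) ?_ ?_ ?_ ?_ ?_
  · intro n hn
    simp only [Finset.mem_range] at hn
    simp only [Finset.mem_filter, Finset.mem_univ, true_and, Fin.le_def]
    omega
  · intro t ht
    simp only [Finset.mem_filter, Finset.mem_univ, true_and, Fin.le_def] at ht
    simp only [Finset.mem_range]
    omega
  · intros; rfl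
  · intros; rfl
  · intros; rfl

/-- The telescoping argument. -/
lemma telescope (C : CartanADE J) {L : ℕ} (ii : Fin L → J) (Λ : J → J → ℚ)
    (hΛ : IsFundWeights C Λ) (ι : J) (k0 k1 : Fin L) (h0 : ii k0 = ι) (h1 : ii k1 = ι)
    (h01 : k0.1 < k1.1) (hno : ∀ t : Fin L, k0.1 < t.1 → t.1 < k1.1 → ii t ≠ ι)
    (m : (J → ℤ) → ℤ)
    (hm : ∀ t, m (betaOf C ii t) = (if t.1 = k0.1 then 1 else 0) + (if t.1 = k1.1 then 1 else 0)
      - (if k0.1 < t.1 ∧ t.1 < k1.1 ∧ C.a (ii t) ι = -1 then 1 else 0)) (k : Fin L) :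
    rhoOf C ii Λ m k = if k = k0 then 1 else 0 := by
  -- the letters and the pairings as functions on the natural numbers
  set w : ℕ → J := fun n => if h : n < L then ii ⟨n, h⟩ else ι with hw
  have hwt : ∀ t : Fin L, w t.1 = ii t := by intro t; simp [hw]
  set V := tailVec C ii (Λ (ii k)) k.1 with hV
  set y : ℕ → ℚ := fun n => pairingQ C (V (n + 1)) (rt (w n)) with hy
  set F : ℕ → ℚ := fun n => pairingQ C (V n) (rt ι) with hF
  set b : ℕ → ℚ := fun n => if k0.1 < n ∧ n < k1.1 ∧ C.a (w n) ι = -1 then y n else 0 with hb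
  have hstep : ∀ n, n ≤ k.1 → F n = F (n + 1) - y n * (C.a (w n) ι : ℚ) := by
    intro n hn
    have hnL : n < L := by have := k.2; omega
    have := tailVec_step C ii (Λ (ii k)) k.1 ⟨n, hnL⟩ hn
    simp only [hF, hy, hV]
    rw [show tailVec C ii (Λ (ii k)) k.1 n = _ from this, pair_reflQ_left, pair_rt_rt,
      ← hwt ⟨n, hnL⟩]
  have hend : F (k.1 + 1) = if ii k = ι then 1 else 0 := by
    simp only [hF, hV]
    rw [tailVec_end]
    exact hΛ (ii k) ι
  have hrho : rhoOf C ii Λ m k = ∑ n ∈ Finset.range (k.1 + 1),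
      ((if n = k0.1 then y n else 0) + (if n = k1.1 then y n else 0) - b n) := by
    unfold rhoOf
    rw [← sum_fin_le]
    refine Finset.sum_congr rfl fun t ht => ?_
    simp only [Finset.mem_filter, Finset.mem_univ, true_and] at ht
    rw [hm, nuBetaPair_eq C ii Λ k t ht]
    simp only [hb, hy, hwt]
    push_cast
    rw [sub_mul, add_mul]
    simp only [ite_mul, one_mul, zero_mul]
    rfl
  rw [hrho, Finset.sum_sub_distrib, Finset.sum_add_distrib, Finset.sum_ite_eq', Finset.sum_ite_eq']
  simp only [Finset.mem_range]
  have hw0 : w k0.1 = ι := by rw [hwt, h0]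
  have hw1 : w k1.1 = ι := by rw [hwt, h1]
  have hy0 : y k0.1 = F (k0.1 + 1) := by simp only [hy, hF, hw0]
  -- partial sums
  have hsmall : ∀ n, n ≤ k0.1 + 1 → ∑ i ∈ Finset.range n, b i = 0 := by
    intro n hn
    refine Finset.sum_eq_zero fun i hi => ?_
    simp only [Finset.mem_range] at hi
    simp only [hb]
    rw [if_neg]; omega
  have htel : ∀ n, k0.1 + 1 ≤ n → n ≤ k1.1 → n ≤ k.1 + 1 →
      F (k0.1 + 1) = F n + ∑ i ∈ Finset.range n, b i := by
    intro n hn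
    induction n, hn using Nat.le_induction with
    | base => intro _ _; rw [hsmall _ le_rfl, add_zero]
    | succ n hn ih =>
      intro g1 g2
      rw [ih (by omega) (by omega), hstep n (by omega), Finset.sum_range_succ]
      have hnL : n < L := by have := k.2; omega
      have hne : w n ≠ ι := by
        have := hno ⟨n, hnL⟩ (by simp; omega) (by simp; omega)
        rwa [← hwt] at this
      have hbn : b n = - (y n * (C.a (w n) ι : ℚ)) := by
        simp only [hb]
        rcases C.offDiag _ _ hne with h | h
        · rw [if_neg (by omega), h]; simp
        · rw [if_pos (by omega), h]; simp
      rw [hbn]; ring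
  by_cases c0 : k.1 < k0.1
  · rw [if_neg (by omega), if_neg (by omega), hsmall _ (by omega), if_neg (by
      intro h; rw [h] at c0; omega)]
    simp
  by_cases c1 : k.1 < k1.1
  · rw [if_pos (by omega), if_neg (by omega), hy0, htel (k.1 + 1) (by omega) (by omega) le_rfl,
      hend]
    have : (ii k = ι) ↔ k = k0 := by
      constructor
      · intro h
        by_contra hne
        have : k.1 ≠ k0.1 := fun h => hne (Fin.ext h)
        exact hno k (by omega) c1 h
      · rintro rfl; exact h0
    simp only [this]
    ring
  · rw [if_pos (by omega), if_pos (by omega), if_neg (by intro h; rw [h] at c1; omega), hy0,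
      htel k1.1 (by omega) le_rfl (by omega), hstep k1.1 (by omega)]
    have hF1 : F (k1.1 + 1) = y k1.1 := by simp only [hy, hF, hw1]
    rw [hF1, hw1, C.diag]
    have hrest : ∑ i ∈ Finset.range (k.1 + 1), b i = ∑ i ∈ Finset.range k1.1, b i := by
      symm
      apply Finset.sum_subset
      · intro i hi
        simp only [Finset.mem_range] at hi ⊢
        omega
      · intro i _ hi
        simp only [Finset.mem_range] at hi
        simp only [hb]
        rw [if_neg]; omega
    rw [hrest]
    push_cast
    ring

/-- Lemma 6.5(ii): with `𝐦 = Ω_Q^{-1}(α_{\barι,p})`, there is a unique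
`k₀` with `Ω̃_Q(β_{k₀}) = (ι, p + 𝗌_{\barι})`, and
`Σ_{t ≤ k} 𝐦(β_t)(ν_k, β_t) = δ_{k,k₀}` for all `k`. -/
theorem statement13 (C : CartanADE J) (D : DiagAut C) (ξ : J → ℤ)
    (hξ : IsHeightFunction C D ξ)
    (c : J → J → ℤ) (hc : IsFoldedCartan C D.σ c)
    (L : ℕ) (ii : Fin L → J) (hr : IsReducedWord C ii) (ha : IsAdapted C D ξ ii)
    (Λ : J → J → ℚ) (hΛ : IsFundWeights C Λ)
    (ι : J) (p : ℤ)
    (hm : InImOmega D.σ ξ ii (ι, p - (orbitSize D.σ ι : ℤ)))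
    (hp : InImOmega D.σ ξ ii (ι, p + (orbitSize D.σ ι : ℤ)))
    (m : (J → ℤ) → ℤ) (hm0 : ∀ v : J → ℤ, v ∉ posRoots C → m v = 0)
    (hmeq : OmegaQmap C D.σ ξ ii m = lrootF D.σ c ι p) :
    (∃! k0 : Fin L, ii k0 = ι ∧ heightAt D.σ ξ ii k0 = p + (orbitSize D.σ ι : ℤ)) ∧
    (∀ k0 : Fin L, ii k0 = ι → heightAt D.σ ξ ii k0 = p + (orbitSize D.σ ι : ℤ) →
        ∀ k : Fin L, rhoOf C ii Λ m k = if k = k0 then 1 else 0) := by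
  obtain ⟨f, hf⟩ := exists_weylVec C Λ hΛ
  have hone : ∀ i j, C.a i j = -1 → orbitSize D.σ i < orbitSize D.σ j → orbitSize D.σ i = 1 :=
    fun i j h hlt => small_eq_one C D ξ hξ f hf h hlt
  have hsep : ∀ v, OrbSep D.σ ξ v := fun v => (structure_lemma C D ξ hξ f hf v).2
  have hE := edgeInv_hgt C D ξ hξ hone ii ha
  have hpos := orbitSize_pos D.σ ι
  constructor
  · obtain ⟨k0, h0, e0⟩ := hp
    simp only at h0 e0
    refine ⟨k0, ⟨h0, e0⟩, ?_⟩
    rintro k ⟨h, e⟩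
    exact time_unique D.σ ξ ii k k0 (by rw [h, h0]) (e.trans e0.symm)
  · intro k0 h0 e0 k
    obtain ⟨k1, h1, e1⟩ := hm
    simp only at h1 e1
    have e0' : hgt D.σ ξ ii k0.1 ι = p + orbitSize D.σ ι := by rw [← h0] at e0 ⊢; exact e0
    have e1' : hgt D.σ ξ ii k1.1 ι = p - orbitSize D.σ ι := by rw [← h1] at e1 ⊢; exact e1
    have hwin := hgt_window D.σ ξ ii ι p k0 k1 h0 h1 e0' e1'
    refine telescope C ii Λ hΛ ι k0 k1 h0 h1 ((hwin k1.1).1 e1').1 ?_ m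
      (coeff_m C D ξ hone hsep c hc ii ha hE ι p k0 k1 h0 h1 e0' e1' m hmeq) k
    intro t g0 g1 ht
    have a1 := (hwin t.1).2 ⟨g0, g1.le⟩
    have := time_unique D.σ ξ ii t k1 (by rw [ht, h1]) (by rw [ht, h1, a1, e1'])
    rw [this] at g1
    exact lt_irrefl _ g1

end QDatumPaper
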